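/- Fix an integer r ≥ 1. There is a constant C_r > 0 depending only on r such that for every n ≥ 2r, every σ > 0, every θ* ∈ ℝ^n, and every V ≥ 0 with n^{r−1}‖D^{(r)}θ*‖₁ ≤ V, the constrained trend filtering estimator θ̂^{(r)}_V satisfies R(θ̂^{(r)}_V, θ*) ≤ C_r · max( (σ² V^{1/r}/n)^{2r/(2r+1)}, (σ²/n)·log(en) ). Moreover, for every x > 0, with probability at least 1 − e^{−x}, (1/n)‖θ̂^{(r)}_V − θ*‖² ≤ C_r · max( (σ² V^{1/r}/n)^{2r/(2r+1)}, (σ²/n)·log(en) ) + 4σ²x/n. -/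

import Mathlib

open MeasureTheory ProbabilityTheory
open scoped BigOperators

noncomputable section

/-- Zero-padding of a finite vector to a sequence on `ℕ`. -/
def pad {n : ℕ} (θ : Fin n → ℝ) : ℕ → ℝ := fun t => if h : t < n then θ ⟨t, h⟩ else 0

/-- First-order forward difference of a sequence. -/
def dseq (f : ℕ → ℝ) : ℕ → ℝ := fun t => f (t + 1) - f t

/-- `DD r θ t` is the `t`-th entry (0-indexed) of the `r`-th order difference `D^{(r)} θ`
of the vector `θ ∈ ℝ^n`; only the entries `t < n - r` are meaningful. -/
def DD (r : ℕ) {n : ℕ} (θ : Fin n → ℝ) : ℕ → ℝ := dseq^[r] (pad θ)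

/-- The ℓ¹ norm `‖D^{(r)} θ‖₁`. -/
def Dl1 (r : ℕ) {n : ℕ} (θ : Fin n → ℝ) : ℝ := ∑ t ∈ Finset.range (n - r), |DD r θ t|

/-- The number of nonzero entries `‖D^{(r)} θ‖₀`. -/
def Dl0 (r : ℕ) {n : ℕ} (θ : Fin n → ℝ) : ℕ :=
  ((Finset.range (n - r)).filter fun t => DD r θ t ≠ 0).card

/-- Squared Euclidean norm. -/
def sqnorm {n : ℕ} (x : Fin n → ℝ) : ℝ := ∑ i, x i ^ 2

/-- Euclidean norm. -/
def eunorm {n : ℕ} (x : Fin n → ℝ) : ℝ := Real.sqrt (sqnorm x)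

/-- `V^{(r)}(θ) = n^{r-1} ‖D^{(r)} θ‖₁`. -/
def Vr (r : ℕ) {n : ℕ} (θ : Fin n → ℝ) : ℝ := (n : ℝ) ^ ((r : ℤ) - 1) * Dl1 r θ

/-- The constraint set `K^{(r)}(V) = {θ : ‖D^{(r)} θ‖₁ ≤ V n^{1-r}}`. -/
def Kset (r n : ℕ) (V : ℝ) : Set (Fin n → ℝ) := {θ | Dl1 r θ ≤ V * (n : ℝ) ^ (1 - (r : ℤ))}

/-- `est` is a least-squares projection onto the set `K`. -/
def IsProjOn {n : ℕ} (est : (Fin n → ℝ) → Fin n → ℝ) (K : Set (Fin n → ℝ)) : Prop :=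
  ∀ y, est y ∈ K ∧ ∀ θ ∈ K, sqnorm (y - est y) ≤ sqnorm (y - θ)

/-- `est` is the penalized trend filtering estimator of order `r` with noise level `σ`
and tuning parameter `lam`: it minimizes `½‖y - θ‖² + σ n^{r-1} lam ‖D^{(r)} θ‖₁`. -/
def IsPenEst (r : ℕ) {n : ℕ} (σ lam : ℝ) (est : (Fin n → ℝ) → Fin n → ℝ) : Prop :=
  ∀ y θ, 1 / 2 * sqnorm (y - est y) + σ * (n : ℝ) ^ ((r : ℤ) - 1) * lam * Dl1 r (est y) ≤
    1 / 2 * sqnorm (y - θ) + σ * (n : ℝ) ^ ((r : ℤ) - 1) * lam * Dl1 r θ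

/-- The Gaussian measure `N_n(0, σ² I_n)` on `ℝ^n`. -/
def gaussVec (n : ℕ) (σ : ℝ) : Measure (Fin n → ℝ) :=
  Measure.pi fun _ => gaussianReal 0 (σ ^ 2).toNNReal

/-- The risk `R(θ̂, θ*) = (1/n) E ‖θ̂(θ* + ξ) - θ*‖²` for `ξ ∼ N_n(0, σ² I_n)`. -/
def risk {n : ℕ} (σ : ℝ) (est : (Fin n → ℝ) → Fin n → ℝ) (θs : Fin n → ℝ) : ℝ :=
  1 / (n : ℝ) * ∫ ξ, sqnorm (est (θs + ξ) - θs) ∂gaussVec n σ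

/-- `j` (with signs `sg`) enumerates, in increasing order and paper (1-indexed) convention,
exactly the `r`-th order knots of `θ ∈ ℝ^n`; an index `2 ≤ m ≤ n - r + 1` is a knot when
`(D^{(r-1)}θ)_{m-1} ≠ (D^{(r-1)}θ)_m` (1-indexed entries), and its sign is `+1` when
`(D^{(r-1)}θ)_{m-1} < (D^{(r-1)}θ)_m` and `-1` otherwise. -/
def IsKnotSeq (r n : ℕ) (θ : Fin n → ℝ) (k : ℕ) (j : Fin k → ℕ) (sg : Fin k → ℝ) : Prop :=
  StrictMono j ∧ (∀ i, 2 ≤ j i ∧ j i ≤ n - r + 1) ∧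
    (∀ m : ℕ, 2 ≤ m → m ≤ n - r + 1 →
      (DD (r - 1) θ (m - 2) ≠ DD (r - 1) θ (m - 1) ↔ ∃ i, j i = m)) ∧
    ∀ i, sg i = if DD (r - 1) θ (j i - 2) < DD (r - 1) θ (j i - 1) then 1 else -1

/-- Extended knot sequence: `jext 0 = j_0 = 1`, `jext i = j_i` for `1 ≤ i ≤ k`, and
`jext (k+1) = j_{k+1} = n - r + 2`. -/
def jext (n r k : ℕ) (j : Fin k → ℕ) : ℕ → ℕ := fun i =>
  if i = 0 then 1 else if h : i - 1 < k then j ⟨i - 1, h⟩ else n - r + 2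

/-- Extended sign sequence: `sgext i = 𝔯_i` for `1 ≤ i ≤ k` and `0` otherwise. -/
def sgext (k : ℕ) (sg : Fin k → ℝ) : ℕ → ℝ := fun i =>
  if h : 0 < i ∧ i - 1 < k then sg ⟨i - 1, h.2⟩ else 0

/-- The lengths `n_0 = j_1 + r - 2`, `n_i = j_{i+1} - j_i` (`1 ≤ i ≤ k-1`),
`n_k = n - r + 2 - j_k`. -/
def nlen (n r k : ℕ) (j : Fin k → ℕ) : ℕ → ℕ := fun i =>
  if i = 0 then jext n r k j 1 + r - 2 else jext n r k j (i + 1) - jext n r k j i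

/-- `n_{i*} = min(n_i, n/(k+1))`. -/
def nstar (n r k : ℕ) (j : Fin k → ℕ) (i : ℕ) : ℝ :=
  min (nlen n r k j i : ℝ) ((n : ℝ) / ((k : ℝ) + 1))

/-- `δ_r(θ)²` defined from the knot data of `θ`. -/
def deltaSq (n r k : ℕ) (j : Fin k → ℕ) (sg : Fin k → ℝ) : ℝ :=
  nstar n r k j 0 ^ (1 - 2 * (r : ℤ)) + nstar n r k j k ^ (1 - 2 * (r : ℤ)) +
    ∑ i ∈ Finset.Ico 1 k,
      if sgext k sg i ≠ sgext k sg (i + 1) then nstar n r k j i ^ (1 - 2 * (r : ℤ)) else 0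

/-- `Δ_r(θ)` defined from the knot data of `θ`. -/
def DeltaR (n r k : ℕ) (j : Fin k → ℕ) (sg : Fin k → ℝ) : ℝ :=
  ((k : ℝ) + 1) / (n : ℝ) * Real.log (Real.exp 1 * (n : ℝ) / ((k : ℝ) + 1)) +
    deltaSq n r k j sg / (n : ℝ) * ((n : ℝ) / ((k : ℝ) + 1)) ^ (2 * (r : ℤ) - 1) *
      Real.log (Real.exp 1 * (n : ℝ) / ((k : ℝ) + 1)) +
    (Real.sqrt (deltaSq n r k j sg) / Real.sqrt (n : ℝ)) ^ ((1 : ℝ) / (r : ℝ))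

/-- The minimum length condition with constant `c`: `n_i ≥ c n/(k+1)` for every `0 ≤ i ≤ k`
with `𝔯_i ≠ 𝔯_{i+1}` (where `𝔯_0 = 𝔯_{k+1} = 0`). -/
def MinLen (n r k : ℕ) (j : Fin k → ℕ) (sg : Fin k → ℝ) (c : ℝ) : Prop :=
  ∀ i ≤ k, sgext k sg i ≠ sgext k sg (i + 1) →
    c * (n : ℝ) / ((k : ℝ) + 1) ≤ (nlen n r k j i : ℝ)

/-- The subdifferential of `g` at `θ`. -/
def subdiff {n : ℕ} (g : (Fin n → ℝ) → ℝ) (θ : Fin n → ℝ) : Set (Fin n → ℝ) :=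
  {v | ∀ y, g θ + ∑ i, v i * (y i - θ i) ≤ g y}

/-- `v` is the minimum-norm element of `S`. -/
def IsMinNormIn {n : ℕ} (v : Fin n → ℝ) (S : Set (Fin n → ℝ)) : Prop :=
  v ∈ S ∧ ∀ w ∈ S, eunorm v ≤ eunorm w

/-- `c • S`. -/
def scaleSet {n : ℕ} (c : ℝ) (S : Set (Fin n → ℝ)) : Set (Fin n → ℝ) := (c • ·) '' S

/-- The cone generated by `S`: `⋃_{c ≥ 0} c • S`. -/
def coneOf {n : ℕ} (S : Set (Fin n → ℝ)) : Set (Fin n → ℝ) := ⋃ c ∈ Set.Ici (0 : ℝ), scaleSet c S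

/-- Euclidean distance from a point to a set. -/
def distSet {n : ℕ} (z : Fin n → ℝ) (S : Set (Fin n → ℝ)) : ℝ :=
  sInf ((fun v => eunorm (z - v)) '' S)

/-- Gaussian mean squared distance `D(S) = E dist²(Z, S)`, `Z ∼ N_n(0, I_n)`. -/
def gaussMSD {n : ℕ} (S : Set (Fin n → ℝ)) : ℝ := ∫ z, distSet z S ^ 2 ∂gaussVec n 1

/-- `lam z` is, for each `z`, the minimizer over `λ ≥ 0` of `dist(z, λ S)`. -/
def IsLamFun {n : ℕ} (S : Set (Fin n → ℝ)) (lam : (Fin n → ℝ) → ℝ) : Prop :=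
  ∀ z, 0 ≤ lam z ∧ ∀ μ : ℝ, 0 ≤ μ → distSet z (scaleSet (lam z) S) ≤ distSet z (scaleSet μ S)

/-- Euclidean covering number of `K` at scale `ε`. -/
def covN {n : ℕ} (ε : ℝ) (K : Set (Fin n → ℝ)) : ℕ :=
  sInf {m : ℕ | ∃ a : Fin m → Fin n → ℝ, ∀ x ∈ K, ∃ i, eunorm (x - a i) ≤ ε}

/-- `K` `t`-shatters the (finite) index set `A`. -/
def fatShatters {n : ℕ} (K : Set (Fin n → ℝ)) (t : ℝ) (A : Finset (Fin n)) : Prop :=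
  ∃ h : Fin n → ℝ, ∀ S : Finset (Fin n), S ⊆ A →
    ∃ θ ∈ K, (∀ i ∈ S, θ i ≤ h i) ∧ ∀ i ∈ A, i ∉ S → h i + t ≤ θ i

/-- The fat shattering dimension `v(K, t)`. -/
def fatDim {n : ℕ} (K : Set (Fin n → ℝ)) (t : ℝ) : ℕ :=
  sSup {m : ℕ | ∃ A : Finset (Fin n), A.card = m ∧ fatShatters K t A}

/-- The tangent cone of `K` at `θ`. -/
def tanCone {n : ℕ} (K : Set (Fin n → ℝ)) (θ : Fin n → ℝ) : Set (Fin n → ℝ) :=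
  closure {w | ∃ t : ℝ, 0 ≤ t ∧ ∃ η ∈ K, w = t • (η - θ)}

/-- `V_{a,b}(f) = Σ_{m=a+1}^{b} |f_m - f_{m-1}|` for the (paper 1-indexed) sequence whose
`m`-th entry is `f (m-1)`. -/
def Vab (f : ℕ → ℝ) (a b : ℕ) : ℝ := ∑ t ∈ Finset.Ico (a - 1) (b - 1), |f (t + 1) - f t|

/-- `Acoef r n v j = Σ_{i=j}^n C(r+i-j-1, r-1) v_i` (paper 1-indexed). -/
def Acoef (r n : ℕ) (v : Fin n → ℝ) (jj : ℕ) : ℝ :=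
  ∑ i : Fin n, (if jj ≤ i.1 + 1 then ((r + (i.1 + 1) - jj - 1).choose (r - 1) : ℝ) else 0) * v i

/-- The class `C_r({a_i}, {s_i})`. -/
def Cras (r n : ℕ) (a s : ℕ → ℝ) : Set (Fin n → ℝ) :=
  {θ | (∀ i < r - 1, a i ≤ DD i θ 0 ∧ DD i θ 0 ≤ a i + s i) ∧
    a (r - 1) ≤ DD (r - 1) θ 0 ∧
    (∀ t : ℕ, t + 1 ≤ n - r → DD (r - 1) θ t ≤ DD (r - 1) θ (t + 1)) ∧
    DD (r - 1) θ (n - r) ≤ a (r - 1) + s (r - 1)}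

/-- The class `C_r(a, V) = {θ : a ≤ (D^{(r-1)}θ)_1 ≤ ⋯ ≤ (D^{(r-1)}θ)_{n-r+1} ≤ a + V}`. -/
def CrMono (r n : ℕ) (a V : ℝ) : Set (Fin n → ℝ) :=
  {θ | a ≤ DD (r - 1) θ 0 ∧
    (∀ t : ℕ, t + 1 ≤ n - r → DD (r - 1) θ t ≤ DD (r - 1) θ (t + 1)) ∧
    DD (r - 1) θ (n - r) ≤ a + V}




lemma exp_sq4_integrable : Integrable (fun g : ℝ => Real.exp (g ^ 2 / 4)) (gaussianReal 0 1) ∧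
    ∫ g, Real.exp (g ^ 2 / 4) ∂(gaussianReal 0 1) = √2 := by
  have key : ∀ x : ℝ, gaussianPDFReal 0 1 x • Real.exp (x ^ 2 / 4) =
      (√(2 * Real.pi))⁻¹ * Real.exp (-(1/4) * x ^ 2) := by
    intro x
    simp only [gaussianPDFReal, smul_eq_mul, mul_assoc, ← Real.exp_add]
    norm_num
    ring_nf
    simp
  constructor
  · rw [gaussianReal_of_var_ne_zero _ one_ne_zero]
    rw [integrable_withDensity_iff_integrable_smul' (measurable_gaussianPDF _ _)
      (ae_of_all _ fun _ ↦ gaussianPDF_lt_top)]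
    simp only [toReal_gaussianPDF, key]
    exact (integrable_exp_neg_mul_sq (by norm_num)).const_mul _
  · rw [integral_gaussianReal_eq_integral_smul one_ne_zero]
    simp only [key]
    rw [integral_const_mul, integral_gaussian, ← Real.sqrt_inv, ← Real.sqrt_mul (by positivity)]
    congr 1
    field_simp
    norm_num

lemma soft_bound (g l : ℝ) (hl : 0 ≤ l) :
    Real.exp ((max (|g| - l) 0) ^ 2 / 4) ≤ 1 + Real.exp (-(l ^ 2) / 4) * Real.exp (g ^ 2 / 4) := by
  rcases le_total (|g| - l) 0 with h | h
  · rw [max_eq_right h]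
    simp
    positivity
  · rw [max_eq_left h, ← Real.exp_add]
    have : Real.exp ((|g| - l) ^ 2 / 4) ≤ Real.exp (-(l ^ 2) / 4 + g ^ 2 / 4) := by
      apply Real.exp_le_exp.2
      have := sq_abs g
      nlinarith
    linarith

lemma soft_integrable (l : ℝ) (hl : 0 ≤ l) :
    Integrable (fun g : ℝ => Real.exp ((max (|g| - l) 0) ^ 2 / 4)) (gaussianReal 0 1) := by
  refine Integrable.mono' ((integrable_const (1:ℝ)).add
    (exp_sq4_integrable.1.const_mul (Real.exp (-(l ^ 2) / 4)))) ?_ ?_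
  · exact (by fun_prop : Measurable _).aestronglyMeasurable
  · refine ae_of_all _ fun g => ?_
    rw [Real.norm_of_nonneg (Real.exp_pos _).le]
    exact soft_bound g l hl

lemma soft_integral (l : ℝ) (hl : 0 ≤ l) :
    ∫ g, Real.exp ((max (|g| - l) 0) ^ 2 / 4) ∂(gaussianReal 0 1) ≤
      Real.exp (2 * Real.exp (-(l ^ 2) / 4)) := by
  have h1 : ∫ g, Real.exp ((max (|g| - l) 0) ^ 2 / 4) ∂(gaussianReal 0 1) ≤
      ∫ g, (1 + Real.exp (-(l ^ 2) / 4) * Real.exp (g ^ 2 / 4)) ∂(gaussianReal 0 1) := by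
    refine integral_mono (soft_integrable l hl) ((integrable_const (1:ℝ)).add
      (exp_sq4_integrable.1.const_mul (Real.exp (-(l ^ 2) / 4)))) fun g => soft_bound g l hl
  rw [integral_add (integrable_const _) (exp_sq4_integrable.1.const_mul _), integral_const_mul,
    exp_sq4_integrable.2] at h1
  simp at h1
  have h2 : √2 ≤ 2 := by
    rw [Real.sqrt_le_left (by norm_num)]; norm_num
  have h3 := Real.add_one_le_exp (2 * Real.exp (-(l ^ 2) / 4))
  have h4 := Real.exp_pos (-(l ^ 2) / 4)
  rw [neg_div] at *
  nlinarith

/-- The (rescaled) squared norm of the soft-thresholded noise coefficients. -/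
def softY {n : ℕ} {ι : Type} [Fintype ι] (b : OrthonormalBasis ι ℝ (EuclideanSpace ℝ (Fin n)))
    (lam : ι → ℝ) (σ : ℝ) (ξ : Fin n → ℝ) : ℝ :=
  ∑ i, (max (|inner ℝ (b i) (WithLp.toLp 2 ξ)| - σ * lam i) 0) ^ 2 / (4 * σ ^ 2)

lemma gaussVec_eq_map (n : ℕ) (σ : ℝ) : gaussVec n σ =
    (Measure.pi fun _ : Fin n => gaussianReal 0 1).map (fun z => fun i => σ * z i) := by
  have h := Measure.pi_map_pi (μ := fun _ : Fin n => gaussianReal 0 1)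
    (f := fun _ => fun x : ℝ => σ * x) (fun i => by fun_prop)
  rw [h, gaussVec]
  congr 1
  funext i
  rw [gaussianReal_map_const_mul]
  congr 1
  · simp
  · ext; simp [Real.coe_toNNReal _ (sq_nonneg σ)]

lemma softY_scale {n : ℕ} {ι : Type} [Fintype ι]
    (b : OrthonormalBasis ι ℝ (EuclideanSpace ℝ (Fin n)))
    (lam : ι → ℝ) (σ : ℝ) (hσ : 0 < σ) (z : Fin n → ℝ) :
    softY b lam σ (fun i => σ * z i) =
      ∑ i, (max (|inner ℝ (b i) (WithLp.toLp 2 z)| - lam i) 0) ^ 2 / 4 := by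
  unfold softY
  refine Finset.sum_congr rfl fun i _ => ?_
  have h1 : WithLp.toLp 2 (fun i => σ * z i) = σ • (WithLp.toLp 2 z) := by
    ext; simp
  rw [h1, inner_smul_right, abs_mul, abs_of_pos hσ, ← mul_sub]
  have : max (σ * (|inner ℝ (b i) (WithLp.toLp 2 z)| - lam i)) 0 =
      σ * max (|inner ℝ (b i) (WithLp.toLp 2 z)| - lam i) 0 := by
    rw [mul_max_of_nonneg _ _ hσ.le, mul_zero]
  rw [this]
  field_simp

lemma gauss_moment {n : ℕ} {ι : Type} [Fintype ι]
    (b : OrthonormalBasis ι ℝ (EuclideanSpace ℝ (Fin n)))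
    (lam : ι → ℝ) (hlam : ∀ i, 0 ≤ lam i) (σ : ℝ) (hσ : 0 < σ) :
    Integrable (fun ξ => Real.exp (softY b lam σ ξ)) (gaussVec n σ) ∧
    ∫ ξ, Real.exp (softY b lam σ ξ) ∂(gaussVec n σ) ≤
      Real.exp (2 * ∑ i, Real.exp (-(lam i ^ 2) / 4)) := by
  classical
  set h : EuclideanSpace ℝ (Fin n) → ℝ := fun z =>
    Real.exp (∑ i, (max (|inner ℝ (b i) z| - lam i) 0) ^ 2 / 4) with hh
  have hmeas : Measurable h := by
    apply Continuous.measurable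
    rw [hh]
    fun_prop
  have hY : Measurable (fun ξ => Real.exp (softY b lam σ ξ)) := by
    apply Continuous.measurable
    unfold softY
    fun_prop
  have hprod : ∀ x : ι → ℝ, h (∑ i, x i • b i) =
      ∏ i, Real.exp ((max (|x i| - lam i) 0) ^ 2 / 4) := by
    intro x
    rw [hh]
    simp only [Real.exp_sum]
    refine Finset.prod_congr rfl fun i _ => ?_
    have : inner ℝ (b i) (∑ j, x j • b j) = x i := by
      exact b.orthonormal.inner_right_fintype x i
    rw [this]
  have e1 : ∀ z : Fin n → ℝ, Real.exp (softY b lam σ (fun i => σ * z i)) = h (WithLp.toLp 2 z) := by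
    intro z; rw [softY_scale b lam σ hσ]
  have std1 := map_pi_eq_stdGaussian (ι := Fin n)
  have std2 := stdGaussian_eq_map_pi_orthonormalBasis b
  have hm1 : Measurable (fun z : Fin n → ℝ => fun i => σ * z i) := by fun_prop
  have hm2 : Measurable (fun z : Fin n → ℝ => (WithLp.toLp 2 z : EuclideanSpace ℝ (Fin n))) := by
    fun_prop
  have hm3 : Measurable (fun x : ι → ℝ => ∑ i, x i • b i) := by fun_prop
  have int1 : Integrable (fun x : ι → ℝ => ∏ i, Real.exp ((max (|x i| - lam i) 0) ^ 2 / 4))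
      (Measure.pi fun _ : ι => gaussianReal 0 1) :=
    Integrable.fintype_prod (f := fun i y => Real.exp ((max (|y| - lam i) 0) ^ 2 / 4))
      fun i => soft_integrable (lam i) (hlam i)
  constructor
  · rw [gaussVec_eq_map, integrable_map_measure hY.aestronglyMeasurable hm1.aemeasurable]
    have : ((fun ξ => Real.exp (softY b lam σ ξ)) ∘ fun z : Fin n → ℝ => fun i => σ * z i) =
        h ∘ fun z : Fin n → ℝ => (WithLp.toLp 2 z : EuclideanSpace ℝ (Fin n)) := by
      funext z; exact e1 z
    rw [this, ← integrable_map_measure hmeas.aestronglyMeasurable hm2.aemeasurable]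
    erw [std1]
    rw [std2, integrable_map_measure hmeas.aestronglyMeasurable hm3.aemeasurable]
    exact int1.congr (ae_of_all _ fun x => (hprod x).symm)
  · rw [gaussVec_eq_map, integral_map hm1.aemeasurable hY.aestronglyMeasurable]
    simp only [e1]
    rw [← integral_map (f := h) hm2.aemeasurable hmeas.aestronglyMeasurable]
    erw [std1]
    rw [std2, integral_map hm3.aemeasurable hmeas.aestronglyMeasurable]
    simp only [hprod]
    rw [integral_fintype_prod_eq_prod (fun i y => Real.exp ((max (|y| - lam i) 0) ^ 2 / 4)),
      Finset.mul_sum, Real.exp_sum]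
    exact Finset.prod_le_prod (fun i _ => integral_nonneg fun _ => (Real.exp_pos _).le)
      fun i _ => soft_integral (lam i) (hlam i)


lemma dseq_iter_lin (r : ℕ) (a c : ℝ) (f g : ℕ → ℝ) (t : ℕ) :
    dseq^[r] (fun s => a * f s + c * g s) t = a * dseq^[r] f t + c * dseq^[r] g t := by
  induction r generalizing f g with
  | zero => rfl
  | succ r ih =>
    simp only [Function.iterate_succ, Function.comp]
    rw [← ih]
    have : (dseq fun s => a * f s + c * g s) = fun s => a * dseq f s + c * dseq g s := by
      funext s
      simp only [dseq]
      ring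
    rw [this]

lemma pad_lin {n : ℕ} (a c : ℝ) (θ η : Fin n → ℝ) :
    pad (fun i => a * θ i + c * η i) = fun s => a * pad θ s + c * pad η s := by
  funext s
  unfold pad
  split_ifs <;> simp

lemma DD_lin (r : ℕ) {n : ℕ} (a c : ℝ) (θ η : Fin n → ℝ) (t : ℕ) :
    DD r (fun i => a * θ i + c * η i) t = a * DD r θ t + c * DD r η t := by
  unfold DD
  rw [pad_lin, dseq_iter_lin]

lemma Dl1_lin_le (r : ℕ) {n : ℕ} (a c : ℝ) (θ η : Fin n → ℝ) :
    Dl1 r (fun i => a * θ i + c * η i) ≤ |a| * Dl1 r θ + |c| * Dl1 r η := by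
  unfold Dl1
  rw [Finset.mul_sum, Finset.mul_sum, ← Finset.sum_add_distrib]
  refine Finset.sum_le_sum fun t _ => ?_
  rw [DD_lin, ← abs_mul, ← abs_mul]
  exact abs_add_le _ _

lemma Dl1_sub_le (r : ℕ) {n : ℕ} (θ η : Fin n → ℝ) :
    Dl1 r (θ - η) ≤ Dl1 r θ + Dl1 r η := by
  have := Dl1_lin_le r 1 (-1) θ η
  simp only [abs_neg, abs_one, one_mul] at this
  convert this using 2
  funext i; simp; ring

lemma proj_ineq (r : ℕ) {n : ℕ} (V : ℝ) (est : (Fin n → ℝ) → Fin n → ℝ)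
    (hest : IsProjOn est (Kset r n V)) (θ ξ : Fin n → ℝ) (hθ : θ ∈ Kset r n V) :
    sqnorm (est (θ + ξ) - θ) ≤ ∑ i, ξ i * (est (θ + ξ) - θ) i := by
  obtain ⟨hm, hmin⟩ := hest (θ + ξ)
  set p := est (θ + ξ) with hp
  set u := p - θ with hu
  have key : ∀ s : ℝ, 0 < s → s ≤ 1 → 2 * (sqnorm u - ∑ i, ξ i * u i) ≤ s * sqnorm u := by
    intro s hs0 hs1
    have hmem : (fun i => (1 - s) * p i + s * θ i) ∈ Kset r n V := by
      have h1 := Dl1_lin_le r (1 - s) s p θ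
      rw [abs_of_nonneg (by linarith), abs_of_nonneg hs0.le] at h1
      simp only [Kset, Set.mem_ofPred_eq] at hm hθ ⊢
      nlinarith
    have h2 := hmin _ hmem
    have e1 : sqnorm (θ + ξ - p) = ∑ i, (ξ i - u i) ^ 2 := by
      unfold sqnorm; refine Finset.sum_congr rfl fun i _ => ?_
      simp [hu]; ring
    have e2 : sqnorm (θ + ξ - fun i => (1 - s) * p i + s * θ i) =
        ∑ i, (ξ i - u i) ^ 2 + s * (2 * (∑ i, ξ i * u i - sqnorm u) + s * sqnorm u) := by
      unfold sqnorm
      rw [← Finset.sum_sub_distrib, Finset.mul_sum, Finset.mul_sum, ← Finset.sum_add_distrib,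
        Finset.mul_sum, ← Finset.sum_add_distrib]
      refine Finset.sum_congr rfl fun i _ => ?_
      simp [hu]; ring
    rw [e1, e2] at h2
    have h3 : 0 ≤ s * (2 * (∑ i, ξ i * u i - sqnorm u) + s * sqnorm u) := by linarith
    have h4 := nonneg_of_mul_nonneg_right h3 hs0
    linarith
  by_contra hcon
  push Not at hcon
  have hq : 0 ≤ sqnorm u := Finset.sum_nonneg fun i _ => sq_nonneg _
  set d := sqnorm u - ∑ i, ξ i * u i with hd
  have hdpos : 0 < d := by rw [hd]; linarith
  have h5 := key (min 1 (d / (sqnorm u + 1))) (by positivity) (min_le_left _ _)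
  have h6 : min 1 (d / (sqnorm u + 1)) * sqnorm u ≤ d := by
    calc min 1 (d / (sqnorm u + 1)) * sqnorm u ≤ d / (sqnorm u + 1) * (sqnorm u + 1) := by
          apply mul_le_mul (min_le_right _ _) (by linarith) hq (by positivity)
      _ = d := by field_simp
  linarith

lemma sum_mul_eq {n : ℕ} {ι : Type} [Fintype ι]
    (b : OrthonormalBasis ι ℝ (EuclideanSpace ℝ (Fin n))) (x y : Fin n → ℝ) :
    ∑ i, x i * y i = ∑ k, inner ℝ (b k) (WithLp.toLp 2 x) * inner ℝ (b k) (WithLp.toLp 2 y) := by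
  have h := b.sum_inner_mul_inner (WithLp.toLp 2 x) (WithLp.toLp 2 y)
  rw [PiLp.inner_apply] at h
  simp only [RCLike.inner_apply, conj_trivial] at h
  calc ∑ i, x i * y i = ∑ i, y i * x i := Finset.sum_congr rfl fun i _ => mul_comm _ _
    _ = _ := h.symm
    _ = _ := Finset.sum_congr rfl fun k _ => by rw [real_inner_comm]

lemma main_ineq (r : ℕ) {n : ℕ} {ι : Type} [Fintype ι]
    (b : OrthonormalBasis ι ℝ (EuclideanSpace ℝ (Fin n)))
    (lam : ι → ℝ) (σ : ℝ) (hσ : 0 < σ) (B : ℝ) (hB : 0 ≤ B)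
    (hb : ∀ u : Fin n → ℝ, ∑ k, lam k * |inner ℝ (b k) (WithLp.toLp 2 u)| ≤ B * Dl1 r u)
    (V : ℝ) (est : (Fin n → ℝ) → Fin n → ℝ)
    (hest : IsProjOn est (Kset r n V)) (θ ξ : Fin n → ℝ) (hθ : θ ∈ Kset r n V) :
    sqnorm (est (θ + ξ) - θ) ≤
      4 * σ ^ 2 * softY b lam σ ξ + 4 * σ * B * (V * (n : ℝ) ^ (1 - (r : ℤ))) := by
  have h1 := proj_ineq r V est hest θ ξ hθ
  have hm := (hest (θ + ξ)).1
  have hD := Dl1_sub_le r (est (θ + ξ)) θ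
  set u := est (θ + ξ) - θ with hu
  simp only [Kset, Set.mem_ofPred_eq] at hm hθ
  have h2 := hb u
  have h3 : sqnorm u = ∑ k, inner ℝ (b k) (WithLp.toLp 2 u) ^ 2 := by
    have := sum_mul_eq b u u
    unfold sqnorm
    simp only [pow_two]
    exact this
  rw [sum_mul_eq b] at h1
  have h4 : ∑ k, inner ℝ (b k) (WithLp.toLp 2 ξ) * inner ℝ (b k) (WithLp.toLp 2 u) ≤
      2 * σ ^ 2 * softY b lam σ ξ + sqnorm u / 2 +
        σ * ∑ k, lam k * |inner ℝ (b k) (WithLp.toLp 2 u)| := by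
    rw [h3, softY, Finset.mul_sum, Finset.mul_sum, Finset.sum_div, ← Finset.sum_add_distrib,
      ← Finset.sum_add_distrib]
    refine Finset.sum_le_sum fun k _ => ?_
    set g := inner ℝ (b k) (WithLp.toLp 2 ξ)
    set c := inner ℝ (b k) (WithLp.toLp 2 u)
    have e : 2 * σ ^ 2 * (max (|g| - σ * lam k) 0 ^ 2 / (4 * σ ^ 2)) =
      max (|g| - σ * lam k) 0 ^ 2 / 2 := by field_simp; ring
    rw [e]
    have m1 := le_max_left (|g| - σ * lam k) 0
    set m := max (|g| - σ * lam k) 0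
    have a1 : g * c ≤ |g| * |c| := by rw [← abs_mul]; exact le_abs_self _
    have a2 := abs_nonneg c
    have a3 := sq_abs c
    nlinarith [sq_nonneg (m - |c|)]
  have h5 : σ * ∑ k, lam k * |inner ℝ (b k) (WithLp.toLp 2 u)| ≤
      σ * (B * (2 * (V * (n : ℝ) ^ (1 - (r : ℤ))))) := by
    apply mul_le_mul_of_nonneg_left _ hσ.le
    apply h2.trans
    apply mul_le_mul_of_nonneg_left _ hB
    linarith
  linarith

lemma abstract_bound (r : ℕ) {n : ℕ} (hn : 0 < n) {ι : Type} [Fintype ι]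
    (b : OrthonormalBasis ι ℝ (EuclideanSpace ℝ (Fin n)))
    (lam : ι → ℝ) (hlam : ∀ i, 0 ≤ lam i) (σ : ℝ) (hσ : 0 < σ) (B : ℝ) (hB : 0 ≤ B)
    (hb : ∀ u : Fin n → ℝ, ∑ k, lam k * |inner ℝ (b k) (WithLp.toLp 2 u)| ≤ B * Dl1 r u)
    (N : ℝ) (hN : ∑ k, Real.exp (-(lam k ^ 2) / 4) ≤ N)
    (V : ℝ) (est : (Fin n → ℝ) → Fin n → ℝ)
    (hest : IsProjOn est (Kset r n V)) (θ : Fin n → ℝ) (hθ : θ ∈ Kset r n V)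
    (Q : ℝ) (hQ : 8 * σ ^ 2 * N + 4 * σ * B * (V * (n : ℝ) ^ (1 - (r : ℤ))) ≤ n * Q) :
    risk σ est θ ≤ Q ∧ ∀ x : ℝ, 0 < x → ENNReal.ofReal (1 - Real.exp (-x)) ≤
      gaussVec n σ {ξ | 1 / (n : ℝ) * sqnorm (est (θ + ξ) - θ) ≤ Q + 4 * σ ^ 2 * x / (n : ℝ)} := by
  have hn' : (0 : ℝ) < n := by exact_mod_cast hn
  obtain ⟨hintegr, hle⟩ := gauss_moment b lam hlam σ hσ
  have hle2 : ∫ ξ, Real.exp (softY b lam σ ξ) ∂(gaussVec n σ) ≤ Real.exp (2 * N) :=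
    hle.trans (Real.exp_le_exp.2 (by linarith))
  have hmain := fun ξ => main_ineq r b lam σ hσ B hB hb V est hest θ ξ hθ
  set T := 4 * σ * B * (V * (n : ℝ) ^ (1 - (r : ℤ))) with hT
  have : IsProbabilityMeasure (gaussVec n σ) := by unfold gaussVec; infer_instance
  set Z : (Fin n → ℝ) → ℝ := fun ξ => Real.exp (softY b lam σ ξ - 2 * N) with hZ
  have hZe : Z = fun ξ => Real.exp (-(2 * N)) * Real.exp (softY b lam σ ξ) := by
    funext ξ; rw [hZ, ← Real.exp_add]; ring_nf
  have hZint : Integrable Z (gaussVec n σ) := by rw [hZe]; exact hintegr.const_mul _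
  have hZle : ∫ ξ, Z ξ ∂(gaussVec n σ) ≤ 1 := by
    rw [hZe, integral_const_mul]
    calc _ ≤ Real.exp (-(2 * N)) * Real.exp (2 * N) :=
          mul_le_mul_of_nonneg_left hle2 (Real.exp_pos _).le
      _ = 1 := by rw [← Real.exp_add]; simp
  constructor
  · unfold risk
    have h1 : ∫ ξ, sqnorm (est (θ + ξ) - θ) ∂gaussVec n σ ≤
        ∫ ξ, ((4 * σ ^ 2 * (2 * N - 1) + T) + 4 * σ ^ 2 * Z ξ) ∂gaussVec n σ := by
      refine integral_mono_of_nonneg (ae_of_all _ fun ξ => Finset.sum_nonneg fun i _ => sq_nonneg _)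
        ((integrable_const _).add (hZint.const_mul _)) (ae_of_all _ fun ξ => ?_)
      have h2 := hmain ξ
      have h3 := Real.add_one_le_exp (softY b lam σ ξ - 2 * N)
      have h4 : 4 * σ ^ 2 * softY b lam σ ξ ≤ 4 * σ ^ 2 * (2 * N - 1 + Z ξ) := by
        apply mul_le_mul_of_nonneg_left _ (by positivity)
        simp only [hZ]; linarith
      simp only
      linarith
    rw [integral_add (integrable_const _) (hZint.const_mul _), integral_const_mul] at h1
    simp at h1
    have h5 : 4 * σ ^ 2 * ∫ ξ, Z ξ ∂(gaussVec n σ) ≤ 4 * σ ^ 2 * 1 :=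
      mul_le_mul_of_nonneg_left hZle (by positivity)
    rw [one_div, inv_mul_le_iff₀ hn']
    linarith
  · intro x hx
    set S : Set (Fin n → ℝ) := {ξ | Real.exp x ≤ Z ξ} with hS
    have hSm : MeasurableSet S := by
      have hc : Continuous Z := by
        rw [hZ]; unfold softY; fun_prop
      exact measurableSet_le measurable_const hc.measurable
    have hMarkov : (gaussVec n σ).real S ≤ Real.exp (-x) := by
      have h6 := mul_meas_ge_le_integral_of_nonneg (ae_of_all _ fun ξ => (Real.exp_pos _).le)
        hZint (Real.exp x)
      rw [Real.exp_neg, ← one_div, le_div_iff₀ (Real.exp_pos _), mul_comm]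
      exact h6.trans hZle
    have hsub : Sᶜ ⊆ {ξ | 1 / (n : ℝ) * sqnorm (est (θ + ξ) - θ) ≤
        Q + 4 * σ ^ 2 * x / (n : ℝ)} := by
      intro ξ hξ
      have h7 : softY b lam σ ξ - 2 * N < x := by
        simpa [hS, hZ] using hξ
      have h2 := hmain ξ
      have h8 : 4 * σ ^ 2 * softY b lam σ ξ ≤ 4 * σ ^ 2 * (2 * N + x) :=
        mul_le_mul_of_nonneg_left (by linarith) (by positivity)
      simp only [Set.mem_ofPred_eq]
      rw [one_div, inv_mul_le_iff₀ hn', mul_add, mul_div_cancel₀ _ hn'.ne']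
      linarith
    refine le_trans ?_ (measure_mono hsub)
    rw [← ofReal_measureReal, probReal_compl_eq_one_sub hSm]
    exact ENNReal.ofReal_le_ofReal (by linarith)


lemma dseq_iter_congr (r : ℕ) (f g : ℕ → ℝ) (t : ℕ) (h : ∀ j ≤ r, f (t + j) = g (t + j)) :
    dseq^[r] f t = dseq^[r] g t := by
  induction r generalizing f g with
  | zero => exact h 0 le_rfl
  | succ r ih =>
    simp only [Function.iterate_succ, Function.comp]
    apply ih
    intro j hj
    simp only [dseq]
    rw [h j (by omega), add_assoc, h (j + 1) (by omega)]

lemma dseq_iter_zero (r : ℕ) (t : ℕ) : dseq^[r] (fun _ => 0) t = 0 := by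
  have := dseq_iter_lin r 0 0 (fun _ => 0) (fun _ => 0) t
  simpa using this

/-- Cumulative sums. -/
def csum (g : ℕ → ℝ) : ℕ → ℝ := fun s => ∑ t ∈ Finset.range s, g t

lemma dseq_csum (g : ℕ → ℝ) : dseq (csum g) = g := by
  funext s
  simp [dseq, csum, Finset.sum_range_succ]

lemma dseq_iter_csum (r : ℕ) (g : ℕ → ℝ) : dseq^[r] (csum^[r] g) = g := by
  induction r generalizing g with
  | zero => rfl
  | succ r ih =>
    rw [Function.iterate_succ_apply, Function.iterate_succ_apply', dseq_csum, ih]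

lemma csum_bound (g : ℕ → ℝ) (a l : ℕ) (G : ℝ) (h0 : ∀ t < a, g t = 0)
    (hG : ∀ s, ∑ t ∈ Finset.range s, |g t| ≤ G) (k : ℕ) :
    (∀ s < a, csum^[k + 1] g s = 0) ∧ ∀ s ≤ a + l, |csum^[k + 1] g s| ≤ (l : ℝ) ^ k * G := by
  induction k with
  | zero =>
    constructor
    · intro s hs
      simp only [zero_add, Function.iterate_one, csum]
      exact Finset.sum_eq_zero fun t ht => h0 t ((Finset.mem_range.1 ht).trans hs)
    · intro s _
      simp only [zero_add, Function.iterate_one, csum, pow_zero, one_mul]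
      exact (Finset.abs_sum_le_sum_abs _ _).trans (hG s)
  | succ k ih =>
    obtain ⟨i1, i2⟩ := ih
    have hG0 : 0 ≤ G := by simpa using hG 0
    constructor
    · intro s hs
      rw [Function.iterate_succ_apply']
      exact Finset.sum_eq_zero fun t ht => i1 t ((Finset.mem_range.1 ht).trans hs)
    · intro s hs
      rw [Function.iterate_succ_apply']
      simp only [csum]
      rcases lt_or_ge s a with hsa | hsa
      · rw [Finset.sum_eq_zero fun t ht => i1 t ((Finset.mem_range.1 ht).trans hsa)]
        simp
        positivity
      · rw [← Finset.sum_range_add_sum_Ico _ hsa,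
          Finset.sum_eq_zero fun t ht => i1 t (Finset.mem_range.1 ht), zero_add]
        refine (Finset.abs_sum_le_sum_abs _ _).trans ?_
        refine (Finset.sum_le_card_nsmul _ _ ((l : ℝ) ^ k * G) fun t ht => i2 t ?_).trans ?_
        · have := (Finset.mem_Ico.1 ht).2
          omega
        · rw [nsmul_eq_mul, pow_succ, Nat.card_Ico]
          have : ((s - a : ℕ) : ℝ) ≤ l := by exact_mod_cast (by omega : s - a ≤ l)
          calc ((s - a : ℕ) : ℝ) * ((l : ℝ) ^ k * G) ≤ l * ((l : ℝ) ^ k * G) :=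
                mul_le_mul_of_nonneg_right this (by positivity)
            _ = _ := by ring

lemma zero_of_dseq (r : ℕ) (f : ℕ → ℝ) (a k : ℕ) (h1 : ∀ j < r, f (a + j) = 0)
    (h2 : ∀ t < k, dseq^[r] f (a + t) = 0) : ∀ s < k + r, f (a + s) = 0 := by
  induction r generalizing f with
  | zero => intro s hs; exact h2 s hs
  | succ r ih =>
    have h3 := ih (dseq f) (fun j hj => by
      simp only [dseq]
      rw [h1 j (by omega), add_assoc, h1 (j + 1) (by omega), sub_zero]) h2
    intro s
    induction s with
    | zero => intro _; exact h1 0 (by omega)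
    | succ s ihs =>
      intro hs
      have h4 := h3 s (by omega)
      have h5 := ihs (by omega)
      simp only [dseq] at h4
      rw [← add_assoc]
      linarith

lemma blk_mid {m t r j : ℕ} (h : t / 2 ^ m = (t + r) / 2 ^ m) (hj : j ≤ r) :
    (t + j) / 2 ^ m = t / 2 ^ m := by
  apply le_antisymm
  · rw [h]; exact Nat.div_le_div_right (by omega)
  · exact Nat.div_le_div_right (by omega)

lemma blk_eq {m p t : ℕ} (h : t < 2 ^ m) : (p * 2 ^ m + t) / 2 ^ m = p := by
  rw [add_comm, Nat.add_mul_div_right _ _ (by positivity), Nat.div_eq_of_lt h, zero_add]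

lemma blk_mono {m m' x y : ℕ} (hm : m ≤ m') (h : x / 2 ^ m = y / 2 ^ m) :
    x / 2 ^ m' = y / 2 ^ m' := by
  obtain ⟨d, rfl⟩ := Nat.exists_eq_add_of_le hm
  rw [pow_add, ← Nat.div_div_eq_div_mul, ← Nat.div_div_eq_div_mul, h]

/-- Vectors which are discrete polynomials of degree `< r` on each dyadic block of level `m`. -/
def polyS (r n m : ℕ) : Submodule ℝ (EuclideanSpace ℝ (Fin n)) where
  carrier := {v | ∀ t, t + r < n → t / 2 ^ m = (t + r) / 2 ^ m → DD r v.ofLp t = 0}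
  add_mem' := by
    intro v w hv hw t h1 h2
    have := DD_lin r 1 1 v.ofLp w.ofLp t
    simp only [one_mul] at this
    rw [hv t h1 h2, hw t h1 h2, add_zero] at this
    exact this
  zero_mem' := by
    intro t _ _
    have := DD_lin r 0 0 (0 : Fin n → ℝ) 0 t
    simp only [zero_mul, add_zero] at this
    exact this
  smul_mem' := by
    intro c v hv t h1 h2
    have := DD_lin r c 0 v.ofLp v.ofLp t
    simp only [zero_mul, add_zero] at this
    rw [hv t h1 h2, mul_zero] at this
    exact this

lemma mem_polyS {r n m : ℕ} {v : EuclideanSpace ℝ (Fin n)} :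
    v ∈ polyS r n m ↔ ∀ t, t + r < n → t / 2 ^ m = (t + r) / 2 ^ m → DD r v.ofLp t = 0 := Iff.rfl

/-- Restriction to a dyadic block. -/
def restr {n : ℕ} (m q : ℕ) (v : Fin n → ℝ) : Fin n → ℝ := fun i => if i.1 / 2 ^ m = q then v i else 0

lemma pad_restr {n : ℕ} (m q : ℕ) (v : Fin n → ℝ) (t : ℕ) :
    pad (restr m q v) t = if t / 2 ^ m = q then pad v t else 0 := by
  unfold pad restr
  split_ifs <;> simp_all

lemma DD_restr {r n m m' q t : ℕ} (hm : m ≤ m') (h : t / 2 ^ m = (t + r) / 2 ^ m)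
    (v : Fin n → ℝ) : DD r (restr m' q v) t = if t / 2 ^ m' = q then DD r v t else 0 := by
  have h' := blk_mono hm h
  unfold DD
  split_ifs with hq
  · apply dseq_iter_congr
    intro j hj
    rw [pad_restr, if_pos (by rw [blk_mid h' hj, hq])]
  · rw [← dseq_iter_zero r t]
    apply dseq_iter_congr
    intro j hj
    rw [pad_restr, if_neg (by rw [blk_mid h' hj]; exact hq)]

lemma restr_mem {r n m m' q : ℕ} (hm : m ≤ m') {v : EuclideanSpace ℝ (Fin n)}
    (hv : v ∈ polyS r n m) : WithLp.toLp 2 (restr m' q v.ofLp) ∈ polyS r n m := by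
  intro t h1 h2
  simp only
  rw [DD_restr hm h2, hv t h1 h2, ite_self]

lemma polyS_anti {r n m : ℕ} : polyS r n (m + 1) ≤ polyS r n m := by
  intro v hv t h1 h2
  exact hv t h1 (blk_mono (Nat.le_succ m) h2)

lemma polyS_zero {r n : ℕ} (hr : 1 ≤ r) : polyS r n 0 = ⊤ := by
  rw [eq_top_iff]
  intro v _ t h1 h2
  simp at h2
  omega

/-- The flag truncated at level `M`. -/
def flagS (r n M m : ℕ) : Submodule ℝ (EuclideanSpace ℝ (Fin n)) :=
  if m ≤ M then polyS r n m else ⊥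

lemma flagS_anti {r n M m : ℕ} : flagS r n M (m + 1) ≤ flagS r n M m := by
  unfold flagS
  split_ifs with h1 h2
  · exact polyS_anti
  · omega
  · exact bot_le
  · exact bot_le

lemma flagS_anti' {r n M m m' : ℕ} (h : m ≤ m') : flagS r n M m' ≤ flagS r n M m :=
  antitone_nat_of_succ_le (f := flagS r n M) (fun _ => flagS_anti) h

lemma flagS_restr {r n M m m' q : ℕ} (hm : m ≤ m') {v : EuclideanSpace ℝ (Fin n)}
    (hv : v ∈ flagS r n M m) : WithLp.toLp 2 (restr m' q v.ofLp) ∈ flagS r n M m := by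
  unfold flagS at *
  split_ifs at * with h
  · exact restr_mem hm hv
  · rw [Submodule.mem_bot] at *
    subst hv
    ext i; simp [restr]

/-- Vectors supported in a block. -/
def suppS (n m q : ℕ) : Submodule ℝ (EuclideanSpace ℝ (Fin n)) where
  carrier := {v | ∀ i : Fin n, i.1 / 2 ^ m ≠ q → v i = 0}
  add_mem' := by
    intro v w hv hw i hi
    simp [hv i hi, hw i hi]
  zero_mem' := by intro i _; rfl
  smul_mem' := by
    intro c v hv i hi
    simp [hv i hi]

/-- Wavelet space at level `m` and block `q`. -/
def wavW (r n M m q : ℕ) : Submodule ℝ (EuclideanSpace ℝ (Fin n)) :=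
  flagS r n M m ⊓ suppS n (m + 1) q ⊓ (flagS r n M (m + 1))ᗮ

lemma inner_eq_sum {n : ℕ} (v w : EuclideanSpace ℝ (Fin n)) : inner ℝ v w = ∑ i, v i * w i := by
  rw [PiLp.inner_apply]
  exact Finset.sum_congr rfl fun i _ => by simp [mul_comm]

lemma inner_restr {n m q : ℕ} (v w : EuclideanSpace ℝ (Fin n)) :
    inner ℝ (WithLp.toLp 2 (restr m q v.ofLp)) w = inner ℝ v (WithLp.toLp 2 (restr m q w.ofLp)) := by
  rw [inner_eq_sum, inner_eq_sum]
  refine Finset.sum_congr rfl fun i _ => ?_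
  simp only [restr]
  split_ifs <;> simp

lemma restr_wav {r n M m q : ℕ} {w : EuclideanSpace ℝ (Fin n)} (h1 : w ∈ flagS r n M m)
    (h2 : w ∈ (flagS r n M (m + 1))ᗮ) :
    WithLp.toLp 2 (restr (m + 1) q w.ofLp) ∈ wavW r n M m q := by
  refine ⟨⟨flagS_restr (Nat.le_succ m) h1, ?_⟩, ?_⟩
  · intro i hi
    simp [restr, hi]
  · rw [SetLike.mem_coe, Submodule.mem_orthogonal'] at *
    intro s hs
    rw [inner_restr]
    exact h2 _ (flagS_restr le_rfl hs)

/-- Index type of the blocks. -/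
abbrev BIdx (n M : ℕ) : Type := Σ m : Fin (M + 1), Fin (n / 2 ^ (m.1 + 1) + 1)

lemma sum_restr {n m : ℕ} (v : EuclideanSpace ℝ (Fin n)) :
    ∑ q : Fin (n / 2 ^ m + 1), WithLp.toLp 2 (restr m q.1 v.ofLp) = v := by
  ext i
  have hi : i.1 / 2 ^ m < n / 2 ^ m + 1 :=
    Nat.lt_succ_of_le (Nat.div_le_div_right i.2.le)
  rw [WithLp.ofLp_sum, Finset.sum_apply, Finset.sum_eq_single (⟨i.1 / 2 ^ m, hi⟩)]
  · simp [restr]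
  · intro q _ hq
    simp only [restr]
    rw [if_neg]
    intro h
    apply hq
    ext
    exact h.symm
  · simp

lemma wav_orth (r n M : ℕ) : OrthogonalFamily ℝ (fun p : BIdx n M => wavW r n M p.1.1 p.2.1)
    (fun p => (wavW r n M p.1.1 p.2.1).subtypeₗᵢ) := by
  have key : ∀ (m m' q q' : ℕ) (v w : EuclideanSpace ℝ (Fin n)), m < m' → v ∈ wavW r n M m q →
      w ∈ wavW r n M m' q' → inner ℝ v w = 0 := by
    intro m m' q q' v w h hv hw
    exact (Submodule.mem_orthogonal' _ _).1 hv.2 w (flagS_anti' h hw.1.1)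
  rintro ⟨m, q⟩ ⟨m', q'⟩ hne ⟨v, hv⟩ ⟨w, hw⟩
  simp only [Submodule.coe_subtypeₗᵢ, Submodule.coe_subtype]
  rcases lt_trichotomy m.1 m'.1 with h | h | h
  · exact key _ _ _ _ v w h hv hw
  · have hm : m = m' := Fin.ext h
    subst hm
    rw [inner_eq_sum]
    refine Finset.sum_eq_zero fun i _ => ?_
    by_cases hi : i.1 / 2 ^ (m.1 + 1) = q.1
    · have : i.1 / 2 ^ (m.1 + 1) ≠ q'.1 := by
        intro h'
        apply hne
        have : q = q' := Fin.ext (hi.symm.trans h')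
        rw [this]
      rw [hw.1.2 i this, mul_zero]
    · rw [hv.1.2 i hi, zero_mul]
  · rw [real_inner_comm]
    exact key _ _ _ _ w v h hw hv

lemma wav_top (r n M : ℕ) (hr : 1 ≤ r) : (⨆ p : BIdx n M, wavW r n M p.1.1 p.2.1)ᗮ = ⊥ := by
  rw [eq_bot_iff]
  intro v hv
  have hv' : ∀ m ≤ M, ∀ w, w ∈ flagS r n M m → w ∈ (flagS r n M (m + 1))ᗮ → inner ℝ w v = 0 := by
    intro m hm w h1 h2
    rw [← sum_restr (m := m + 1) w, sum_inner]
    refine Finset.sum_eq_zero fun q _ => ?_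
    refine (Submodule.mem_orthogonal _ _).1 hv _ ?_
    exact Submodule.mem_iSup_of_mem (p := fun p : BIdx n M => wavW r n M p.1.1 p.2.1)
      ⟨⟨m, by omega⟩, q⟩ (restr_wav h1 h2)
  have hd : ∀ d, d ≤ M + 1 → v ∈ (flagS r n M (M + 1 - d))ᗮ := by
    intro d
    induction d with
    | zero =>
      intro _
      simp [flagS]
    | succ d ih =>
      intro hd
      have h1 := ih (by omega)
      set m := M + 1 - (d + 1) with hm
      have hm1 : M + 1 - d = m + 1 := by omega
      rw [hm1] at h1
      rw [Submodule.mem_orthogonal] at h1 ⊢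
      intro s hs
      obtain ⟨p, hp, w, hw, rfl⟩ :=
        Submodule.exists_add_mem_mem_orthogonal (K := flagS r n M (m + 1)) s
      have hws : w ∈ flagS r n M m := by
        have := Submodule.sub_mem _ hs (flagS_anti hp)
        simpa using this
      rw [inner_add_left, h1 p hp, hv' m (by omega) w hws hw, add_zero]
  have h0 := hd (M + 1) le_rfl
  rw [Nat.sub_self, flagS, if_pos (Nat.zero_le _), polyS_zero hr] at h0
  simpa using h0

lemma wav_dim (r n M m q : ℕ) : Module.finrank ℝ (wavW r n M m q) ≤ 2 * r := by
  let F : EuclideanSpace ℝ (Fin n) →ₗ[ℝ] (Fin 2 × Fin r → ℝ) :=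
    { toFun := fun v p => pad v.ofLp ((2 * q + p.1.1) * 2 ^ m + p.2.1)
      map_add' := by
        intro v w; funext p
        have := congrFun (pad_lin 1 1 v.ofLp w.ofLp) ((2 * q + p.1.1) * 2 ^ m + p.2.1)
        simp only [one_mul] at this
        exact this
      map_smul' := by
        intro c v; funext p
        have := congrFun (pad_lin c 0 v.ofLp v.ofLp) ((2 * q + p.1.1) * 2 ^ m + p.2.1)
        simp only [zero_mul, add_zero] at this
        exact this }
  have hinj : Function.Injective (F.comp (wavW r n M m q).subtype) := by
    rw [← LinearMap.ker_eq_bot, LinearMap.ker_eq_bot']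
    rintro ⟨v, hv⟩ hF
    have hF' : ∀ c < 2, ∀ j < r, pad v.ofLp ((2 * q + c) * 2 ^ m + j) = 0 := by
      intro c hc j hj
      exact congrFun hF (⟨c, hc⟩, ⟨j, hj⟩)
    have hS : v ∈ polyS r n m := by
      have : v ∈ flagS r n M m := hv.1.1
      unfold flagS at this
      split_ifs at this
      · exact this
      · rw [Submodule.mem_bot] at this
        rw [this]; exact Submodule.zero_mem _
    apply Subtype.ext
    ext i
    simp only [ZeroMemClass.coe_zero, PiLp.zero_apply]
    by_cases hi : i.1 / 2 ^ (m + 1) = q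
    · have h2 : i.1 / 2 ^ m / 2 = q := by
        rw [Nat.div_div_eq_div_mul, ← pow_succ]; exact hi
      set p := i.1 / 2 ^ m with hp
      obtain ⟨c, hc, hpc⟩ : ∃ c < 2, p = 2 * q + c := ⟨p % 2, Nat.mod_lt _ (by norm_num), by omega⟩
      have his : i.1 = p * 2 ^ m + i.1 % 2 ^ m := by
        rw [hp, mul_comm]; exact (Nat.div_add_mod _ _).symm
      set s := i.1 % 2 ^ m with hs
      have hsl : s < 2 ^ m := Nat.mod_lt _ (by positivity)
      have hz := zero_of_dseq r (pad v.ofLp) (p * 2 ^ m) (s + 1 - r)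
        (by rw [hpc]; exact hF' c hc) (by
          intro t ht
          refine mem_polyS.1 hS _ (by have := i.2; omega) ?_
          rw [add_assoc, blk_eq (by omega), blk_eq (by omega)]) s (by omega)
      rw [← his] at hz
      simpa [pad] using hz
    · exact hv.1.2 i hi
  have := LinearMap.finrank_le_finrank_of_injective hinj
  simpa using this


/-- Local variation in a block. -/
def locV (r : ℕ) {n : ℕ} (u : Fin n → ℝ) (m q : ℕ) : ℝ :=
  ∑ t ∈ (Finset.range (n - r)).filter (fun t => t / 2 ^ m = q), |DD r u t|

lemma locV_nonneg (r : ℕ) {n : ℕ} (u : Fin n → ℝ) (m q : ℕ) : 0 ≤ locV r u m q :=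
  Finset.sum_nonneg fun _ _ => abs_nonneg _

lemma sum_locV (r : ℕ) {n : ℕ} (u : Fin n → ℝ) (m K : ℕ) :
    ∑ q : Fin K, locV r u m q.1 ≤ Dl1 r u := by
  rw [Finset.sum_range (fun q => locV r u m q) |>.symm]
  unfold locV Dl1
  simp only [Finset.sum_filter]
  rw [Finset.sum_comm]
  refine Finset.sum_le_sum fun t _ => ?_
  rw [Finset.sum_ite_eq]
  split_ifs
  · exact le_rfl
  · exact abs_nonneg _

lemma block_approx (r : ℕ) (hr : 1 ≤ r) {n : ℕ} (u : Fin n → ℝ) (m q : ℕ) :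
    ∃ w : Fin n → ℝ, WithLp.toLp 2 (restr m q (u - w)) ∈ polyS r n m ∧
      ∀ i : Fin n, i.1 / 2 ^ m = q → |w i| ≤ ((2 : ℝ) ^ m) ^ (r - 1) * locV r u m q := by
  set g : ℕ → ℝ := fun t =>
    if t ∈ (Finset.range (n - r)).filter (fun t => t / 2 ^ m = q) then DD r u t else 0 with hg
  have hg0 : ∀ t < q * 2 ^ m, g t = 0 := by
    intro t ht
    simp only [hg]
    rw [if_neg]
    intro h
    have h1 := (Finset.mem_filter.1 h).2
    have := (Nat.div_lt_iff_lt_mul (by positivity : 0 < 2 ^ m)).2 ht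
    omega
  have hgG : ∀ s, ∑ t ∈ Finset.range s, |g t| ≤ locV r u m q := by
    intro s
    have : ∀ t, |g t| =
        if t ∈ (Finset.range (n - r)).filter (fun t => t / 2 ^ m = q) then |DD r u t| else 0 := by
      intro t
      simp only [hg]
      split_ifs <;> simp
    simp only [this]
    rw [← Finset.sum_filter]
    unfold locV
    refine Finset.sum_le_sum_of_subset_of_nonneg ?_ fun _ _ _ => abs_nonneg _
    intro t ht
    exact (Finset.mem_filter.1 ht).2
  have hb := csum_bound g (q * 2 ^ m) (2 ^ m) (locV r u m q) hg0 hgG (r - 1)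
  rw [Nat.sub_add_cancel hr] at hb
  refine ⟨fun i => csum^[r] g i.1, ?_, ?_⟩
  · rw [mem_polyS]
    intro t h1 h2
    simp only
    rw [DD_restr le_rfl h2]
    split_ifs with hq
    · have e1 := DD_lin r 1 (-1) u (fun i => csum^[r] g i.1) t
      have e2 : DD r (fun i : Fin n => csum^[r] g i.1) t = g t := by
        conv_rhs => rw [← dseq_iter_csum r g]
        unfold DD
        apply dseq_iter_congr
        intro j hj
        unfold pad
        rw [dif_pos (by omega)]
      have e3 : g t = DD r u t := by
        simp only [hg]
        rw [if_pos]
        rw [Finset.mem_filter, Finset.mem_range]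
        exact ⟨by omega, hq⟩
      have e4 : (u - fun i : Fin n => csum^[r] g i.1) =
          fun i => 1 * u i + (-1) * csum^[r] g i.1 := by
        funext i; simp; ring
      rw [e4, e1, e2, e3]; ring
    · rfl
  · intro i hi
    have := hb.2 i.1 (by
      have h := Nat.lt_div_mul_add (a := i.1) (b := 2 ^ m) (by positivity)
      rw [hi] at h
      omega)
    simpa using this

lemma card_block (n m q : ℕ) :
    (Finset.univ.filter (fun i : Fin n => i.1 / 2 ^ m = q)).card ≤ 2 ^ m := by
  refine (Finset.card_le_card_of_injOn (t := Finset.range (2 ^ m))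
    (fun i => i.1 % 2 ^ m) ?_ ?_).trans (Finset.card_range _).le
  · intro i _
    simp only [Finset.coe_range, Set.mem_Iio]
    exact Nat.mod_lt _ (by positivity)
  · intro i hi j hj h
    simp only [Finset.coe_filter, Finset.mem_univ, true_and, Set.mem_ofPred_eq] at hi hj
    ext
    rw [← Nat.div_add_mod i.1 (2 ^ m), ← Nat.div_add_mod j.1 (2 ^ m), hi, hj]
    simp only at h
    rw [h]

lemma wav_coef (r : ℕ) (hr : 1 ≤ r) {n : ℕ} (M m q : ℕ) (hm : m < M)
    (e : EuclideanSpace ℝ (Fin n)) (he : e ∈ wavW r n M m q) (hn : ‖e‖ = 1) (u : Fin n → ℝ) :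
    |inner ℝ e (WithLp.toLp 2 u)| ≤
      ((2 : ℝ) ^ (m + 1)) ^ (r - 1) * √((2 : ℝ) ^ (m + 1)) * locV r u (m + 1) q := by
  obtain ⟨w, hw1, hw2⟩ := block_approx r hr u (m + 1) q
  set X := ((2 : ℝ) ^ (m + 1)) ^ (r - 1) * locV r u (m + 1) q with hX
  have hX0 : 0 ≤ X := mul_nonneg (by positivity) (locV_nonneg _ _ _ _)
  have horth : inner ℝ e (WithLp.toLp 2 (restr (m + 1) q (u - w))) = 0 := by
    apply (Submodule.mem_orthogonal' _ _).1 he.2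
    unfold flagS
    rw [if_pos (by omega)]
    exact hw1
  rw [inner_eq_sum] at horth
  set Bq := Finset.univ.filter (fun i : Fin n => i.1 / 2 ^ (m + 1) = q) with hBq
  have e1 : inner ℝ e (WithLp.toLp 2 u) = ∑ i ∈ Bq, e i * w i := by
    rw [inner_eq_sum, ← sub_zero (∑ i, _), ← horth, ← Finset.sum_sub_distrib, hBq,
      Finset.sum_filter]
    refine Finset.sum_congr rfl fun i _ => ?_
    simp only [restr]
    split_ifs with h
    · simp
      ring
    · rw [he.1.2 i h]; simp
  have e2 : |∑ i ∈ Bq, e i * w i| ≤ X * ∑ i ∈ Bq, |e i| := by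
    refine (Finset.abs_sum_le_sum_abs _ _).trans ?_
    rw [Finset.mul_sum]
    refine Finset.sum_le_sum fun i hi => ?_
    rw [abs_mul, mul_comm]
    exact mul_le_mul_of_nonneg_right (hw2 i (Finset.mem_filter.1 hi).2) (abs_nonneg _)
  have e3 : ∑ i ∈ Bq, |e i| ≤ √((2 : ℝ) ^ (m + 1)) := by
    apply Real.le_sqrt_of_sq_le
    refine sq_sum_le_card_mul_sum_sq.trans ?_
    have c1 : (Bq.card : ℝ) ≤ 2 ^ (m + 1) := by exact_mod_cast card_block n (m + 1) q
    have c2 : ∑ i ∈ Bq, |e i| ^ 2 ≤ 1 := by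
      have h1 : ∑ i, |e i| ^ 2 = 1 := by
        have := EuclideanSpace.norm_sq_eq e
        rw [hn] at this
        simpa using this.symm
      rw [← h1]
      exact Finset.sum_le_sum_of_subset_of_nonneg (Finset.subset_univ _) fun _ _ _ => sq_nonneg _
    calc (Bq.card : ℝ) * ∑ i ∈ Bq, |e i| ^ 2 ≤ 2 ^ (m + 1) * 1 := by
          apply mul_le_mul c1 c2 (Finset.sum_nonneg fun _ _ => sq_nonneg _) (by positivity)
      _ = _ := mul_one _
  rw [e1]
  calc _ ≤ X * ∑ i ∈ Bq, |e i| := e2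
    _ ≤ X * √((2 : ℝ) ^ (m + 1)) := mul_le_mul_of_nonneg_left e3 hX0
    _ = _ := by rw [hX]; ring

lemma sum_fin_rev (M : ℕ) (f : ℕ → ℝ) :
    ∑ m : Fin (M + 1), f (M - m.1) = ∑ j ∈ Finset.range (M + 1), f j := by
  rw [← Finset.sum_range (fun m => f (M - m)), ← Finset.sum_range_reflect f]
  refine Finset.sum_congr rfl fun j _ => ?_
  congr 1

lemma exp_level (j : ℕ) : Real.exp (-((3 * (j : ℝ)) ^ 2) / 4) ≤ (1 / 4 : ℝ) ^ j := by
  have h1 : (1 / 4 : ℝ) ^ j = Real.exp (-(j * Real.log 4)) := by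
    rw [Real.exp_neg, mul_comm, Real.exp_mul, Real.exp_log (by norm_num)]
    simp
  rw [h1]
  apply Real.exp_le_exp.2
  have h2 : Real.log 4 ≤ 9 / 4 := by
    have : Real.log 4 = 2 * Real.log 2 := by
      rw [show (4 : ℝ) = 2 ^ 2 by norm_num, Real.log_pow]; norm_num
    have := Real.log_two_lt_d9
    linarith
  have h3 : (j : ℝ) ≤ (j : ℝ) ^ 2 := by exact_mod_cast Nat.le_self_pow (by norm_num) j
  have h4 : (0 : ℝ) ≤ j := by positivity
  nlinarith

lemma wav_basis (r n M : ℕ) (hr : 1 ≤ r) :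
    ∃ bb : OrthonormalBasis (Σ p : BIdx n M, Fin (Module.finrank ℝ (wavW r n M p.1.1 p.2.1))) ℝ
      (EuclideanSpace ℝ (Fin n)), ∀ k, bb k ∈ wavW r n M k.1.1.1 k.1.2.1 := by
  classical
  have hI : DirectSum.IsInternal (fun p : BIdx n M => wavW r n M p.1.1 p.2.1) :=
    (wav_orth r n M).isInternal_iff.2 (wav_top r n M hr)
  refine ⟨hI.collectedOrthonormalBasis (wav_orth r n M)
    (fun p => stdOrthonormalBasis ℝ (wavW r n M p.1.1 p.2.1)), fun k => ?_⟩
  exact hI.collectedOrthonormalBasis_mem (wav_orth r n M) _ k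

lemma basis_exists (r : ℕ) (hr : 1 ≤ r) : ∃ C : ℝ, 0 < C ∧ ∀ (n M : ℕ),
    ∃ (ι : Type) (_ : Fintype ι) (b : OrthonormalBasis ι ℝ (EuclideanSpace ℝ (Fin n)))
      (lam : ι → ℝ), (∀ i, 0 ≤ lam i) ∧
      ∑ k, Real.exp (-(lam k ^ 2) / 4) ≤ C * ((n : ℝ) / 2 ^ M + 1) ∧
      ∀ u : Fin n → ℝ, ∑ k, lam k * |inner ℝ (b k) (WithLp.toLp 2 u)| ≤
        C * (((2 : ℝ) ^ M) ^ (r - 1) * √((2 : ℝ) ^ M)) * Dl1 r u := by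
  classical
  have hsum : Summable (fun j : ℕ => (j : ℝ) * (1 / √2) ^ j) := by
    have h := summable_pow_mul_geometric_of_norm_lt_one 1 (r := (1 / √2 : ℝ)) (by
      rw [Real.norm_of_nonneg (by positivity), div_lt_one (by positivity)]
      exact Real.lt_sqrt_of_sq_lt (by norm_num))
    simpa using h
  set K := ∑' j : ℕ, (j : ℝ) * (1 / √2) ^ j with hK
  have hK0 : 0 ≤ K := tsum_nonneg fun j => by positivity
  refine ⟨4 * r + 6 * r * √2 * K, by positivity, ?_⟩
  intro n M
  obtain ⟨bb, hbb⟩ := wav_basis r n M hr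
  refine ⟨_, inferInstance, bb, fun k => 3 * ((M - k.1.1.1 : ℕ) : ℝ), fun k => by positivity, ?_, ?_⟩
  · rw [Fintype.sum_sigma]
    simp only [Finset.sum_const, Finset.card_univ, Fintype.card_fin, nsmul_eq_mul]
    rw [Fintype.sum_sigma]
    have hlev : ∀ m : Fin (M + 1), ∑ q : Fin (n / 2 ^ (m.1 + 1) + 1),
        (Module.finrank ℝ (wavW r n M m.1 q.1) : ℝ) *
          Real.exp (-((3 * ((M - m.1 : ℕ) : ℝ)) ^ 2) / 4) ≤
        2 * r * ((n : ℝ) / 2 ^ M + 1) * (1 / 2) ^ (M - m.1) := by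
      intro m
      calc _ ≤ ∑ q : Fin (n / 2 ^ (m.1 + 1) + 1), (2 * r : ℝ) * (1 / 4) ^ (M - m.1) := by
            refine Finset.sum_le_sum fun q _ => ?_
            apply mul_le_mul _ (exp_level _) (Real.exp_pos _).le (by positivity)
            exact_mod_cast wav_dim r n M m.1 q.1
        _ = ((n / 2 ^ (m.1 + 1) : ℕ) + 1 : ℝ) * ((2 * r : ℝ) * (1 / 4) ^ (M - m.1)) := by
            simp
        _ ≤ (((n : ℝ) / 2 ^ M + 1) * 2 ^ (M - m.1)) * ((2 * r : ℝ) * (1 / 4) ^ (M - m.1)) := by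
            apply mul_le_mul_of_nonneg_right _ (by positivity)
            have c1 : ((n / 2 ^ (m.1 + 1) : ℕ) : ℝ) ≤ (n : ℝ) / 2 ^ (m.1 + 1) := by
              have := Nat.cast_div_le (α := ℝ) (m := n) (n := 2 ^ (m.1 + 1))
              simpa using this
            have c2 : (n : ℝ) / 2 ^ (m.1 + 1) ≤ n / 2 ^ m.1 := by
              apply div_le_div_of_nonneg_left (by positivity) (by positivity)
              exact pow_le_pow_right₀ (by norm_num) (by omega)
            have c3 : (n : ℝ) / 2 ^ m.1 = n / 2 ^ M * 2 ^ (M - m.1) := by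
              have : (2 : ℝ) ^ M = 2 ^ m.1 * 2 ^ (M - m.1) := by
                rw [← pow_add]; congr 1; have := m.2; omega
              rw [this]
              field_simp
            have c4 : (1 : ℝ) ≤ 2 ^ (M - m.1) := one_le_pow₀ (by norm_num)
            rw [add_mul, ← c3]
            linarith
        _ = _ := by
            have : (2 : ℝ) ^ (M - m.1) * (1 / 4) ^ (M - m.1) = (1 / 2) ^ (M - m.1) := by
              rw [← mul_pow]; norm_num
            rw [← this]; ring
    refine (Finset.sum_le_sum fun m _ => hlev m).trans ?_
    rw [← Finset.mul_sum, sum_fin_rev M (fun j => (1 / 2 : ℝ) ^ j)]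
    have hgeo : ∑ j ∈ Finset.range (M + 1), (1 / 2 : ℝ) ^ j ≤ 2 := by
      have := Summable.sum_le_tsum (Finset.range (M + 1)) (fun j _ => by positivity)
        summable_geometric_two
      rwa [tsum_geometric_two] at this
    calc 2 * r * ((n : ℝ) / 2 ^ M + 1) * ∑ j ∈ Finset.range (M + 1), (1 / 2 : ℝ) ^ j
        ≤ 2 * r * ((n : ℝ) / 2 ^ M + 1) * 2 := mul_le_mul_of_nonneg_left hgeo (by positivity)
      _ = 4 * r * ((n : ℝ) / 2 ^ M + 1) := by ring
      _ ≤ _ := by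
        apply mul_le_mul_of_nonneg_right _ (by positivity)
        have : (0 : ℝ) ≤ 6 * r * √2 * K := by positivity
        linarith
  · intro u
    have hD0 : 0 ≤ Dl1 r u := Finset.sum_nonneg fun _ _ => abs_nonneg _
    rw [Fintype.sum_sigma, Fintype.sum_sigma]
    set A := ((2 : ℝ) ^ M) ^ (r - 1) * √((2 : ℝ) ^ M) with hA
    have hlev : ∀ m : Fin (M + 1), ∑ q : Fin (n / 2 ^ (m.1 + 1) + 1),
        ∑ k, 3 * ((M - m.1 : ℕ) : ℝ) * |inner ℝ (bb ⟨⟨m, q⟩, k⟩) (WithLp.toLp 2 u)| ≤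
        6 * r * √2 * A * Dl1 r u * (((M - m.1 : ℕ) : ℝ) * (1 / √2) ^ (M - m.1)) := by
      intro m
      rcases Nat.lt_or_ge m.1 M with hm | hm
      · have hsc : ((2 : ℝ) ^ (m.1 + 1)) ^ (r - 1) * √((2 : ℝ) ^ (m.1 + 1)) ≤
            √2 * A * (1 / √2) ^ (M - m.1) := by
          have s1 : ((2 : ℝ) ^ (m.1 + 1)) ^ (r - 1) ≤ ((2 : ℝ) ^ M) ^ (r - 1) := by
            apply pow_le_pow_left₀ (by positivity)
            exact pow_le_pow_right₀ (by norm_num) (by omega)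
          have s2 : √((2 : ℝ) ^ (m.1 + 1)) = √2 * √((2 : ℝ) ^ M) * (1 / √2) ^ (M - m.1) := by
            have hs : ∀ j : ℕ, √((2 : ℝ) ^ j) = √2 ^ j := fun j => by
              rw [Real.sqrt_eq_iff_mul_self_eq (by positivity) (by positivity), ← mul_pow,
                Real.mul_self_sqrt (by norm_num)]
            rw [hs, hs]
            have : √(2 : ℝ) ^ M = √2 ^ m.1 * √2 ^ (M - m.1) := by
              rw [← pow_add]; congr 1; omega
            rw [this, one_div, inv_pow]
            field_simp
            ring
          rw [s2, hA]
          calc _ ≤ ((2 : ℝ) ^ M) ^ (r - 1) * (√2 * √((2 : ℝ) ^ M) * (1 / √2) ^ (M - m.1)) :=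
                mul_le_mul_of_nonneg_right s1 (by positivity)
            _ = _ := by ring
        calc _ ≤ ∑ q : Fin (n / 2 ^ (m.1 + 1) + 1), (2 * r) * (3 * ((M - m.1 : ℕ) : ℝ) *
              (√2 * A * (1 / √2) ^ (M - m.1) * locV r u (m.1 + 1) q.1)) := by
              refine Finset.sum_le_sum fun q _ => ?_
              refine (Finset.sum_le_card_nsmul _ _ (3 * ((M - m.1 : ℕ) : ℝ) *
                (√2 * A * (1 / √2) ^ (M - m.1) * locV r u (m.1 + 1) q.1)) fun k _ => ?_).trans ?_
              · apply mul_le_mul_of_nonneg_left _ (by positivity)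
                refine (wav_coef r hr M m.1 q.1 hm (bb ⟨⟨m, q⟩, k⟩) (hbb ⟨⟨m, q⟩, k⟩)
                  (bb.orthonormal.1 _) u).trans ?_
                exact mul_le_mul_of_nonneg_right hsc (locV_nonneg _ _ _ _)
              · rw [nsmul_eq_mul]
                apply mul_le_mul_of_nonneg_right
                · rw [Finset.card_univ, Fintype.card_fin]
                  exact_mod_cast wav_dim r n M m.1 q.1
                · have := locV_nonneg r u (m.1 + 1) q.1
                  positivity
          _ = 6 * r * √2 * A * (((M - m.1 : ℕ) : ℝ) * (1 / √2) ^ (M - m.1)) *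
                ∑ q : Fin (n / 2 ^ (m.1 + 1) + 1), locV r u (m.1 + 1) q.1 := by
              rw [Finset.mul_sum]
              refine Finset.sum_congr rfl fun q _ => ?_
              ring
          _ ≤ 6 * r * √2 * A * (((M - m.1 : ℕ) : ℝ) * (1 / √2) ^ (M - m.1)) * Dl1 r u :=
              mul_le_mul_of_nonneg_left (sum_locV r u _ _) (by positivity)
          _ = _ := by ring
      · have : M - m.1 = 0 := by omega
        rw [this]
        simp
    refine (Finset.sum_le_sum fun m _ => hlev m).trans ?_
    rw [← Finset.mul_sum, sum_fin_rev M (fun j => (j : ℝ) * (1 / √2) ^ j)]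
    have hle := Summable.sum_le_tsum (Finset.range (M + 1)) (fun j _ => by positivity) hsum
    calc _ ≤ 6 * r * √2 * A * Dl1 r u * K := mul_le_mul_of_nonneg_left hle (by positivity)
      _ = 6 * r * √2 * K * A * Dl1 r u := by ring
      _ ≤ _ := by
        apply mul_le_mul_of_nonneg_right _ hD0
        apply mul_le_mul_of_nonneg_right _ (by positivity)
        have : (0 : ℝ) ≤ 4 * r := by positivity
        linarith


lemma rate_bound (r : ℕ) (hr : 1 ≤ r) (n : ℕ) (hn : 0 < n) (σ V X : ℝ) (hσ : 0 < σ) (hV : 0 ≤ V)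
    (hX : 0 < X) (h : σ ^ 2 * (n : ℝ) ^ (2 * r) ≤ V ^ 2 * X ^ (2 * r + 1)) :
    σ ^ 2 / X ≤ (σ ^ 2 * V ^ ((1 : ℝ) / (r : ℝ)) / (n : ℝ)) ^
      (2 * (r : ℝ) / (2 * (r : ℝ) + 1)) := by
  have hn' : (0 : ℝ) < n := by exact_mod_cast hn
  have hr' : (0 : ℝ) < r := by exact_mod_cast hr
  set Z := σ ^ 2 * V ^ ((1 : ℝ) / (r : ℝ)) / (n : ℝ) with hZ
  have hZ0 : 0 ≤ Z := by positivity
  have hZp : Z ^ (2 * r) = σ ^ (4 * r) * V ^ 2 / (n : ℝ) ^ (2 * r) := by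
    have h1 : (V ^ ((1 : ℝ) / (r : ℝ))) ^ (2 * r) = V ^ 2 := by
      rw [← Real.rpow_natCast, ← Real.rpow_mul hV]
      rw [← Real.rpow_natCast V 2]
      congr 1
      push_cast
      field_simp
    rw [hZ, div_pow, mul_pow, h1, ← pow_mul]
    ring_nf
  set a := Z ^ (2 * (r : ℝ) / (2 * (r : ℝ) + 1)) with ha
  have ha0 : 0 ≤ a := by positivity
  have hap : a ^ (2 * r + 1) = Z ^ (2 * r) := by
    rw [ha, ← Real.rpow_natCast, ← Real.rpow_mul hZ0, ← Real.rpow_natCast Z (2 * r)]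
    congr 1
    push_cast
    field_simp
  refine le_of_pow_le_pow_left₀ (n := 2 * r + 1) (by omega) ha0 ?_
  rw [hap, hZp, div_pow, div_le_div_iff₀ (by positivity) (by positivity)]
  have e : (σ ^ 2) ^ (2 * r + 1) = σ ^ (4 * r) * σ ^ 2 := by
    rw [← pow_mul, ← pow_add]; congr 1; ring
  rw [e, mul_assoc, mul_assoc]
  exact mul_le_mul_of_nonneg_left h (by positivity)

/-- Theorem: risk of the constrained estimator under weak sparsity. -/
theorem stmt0 (r : ℕ) (hr : 1 ≤ r) :
    ∃ C : ℝ, 0 < C ∧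
      ∀ (n : ℕ), 2 * r ≤ n → ∀ σ : ℝ, 0 < σ → ∀ θstar : Fin n → ℝ, ∀ V : ℝ, 0 ≤ V →
        (n : ℝ) ^ ((r : ℤ) - 1) * Dl1 r θstar ≤ V →
        ∀ est : (Fin n → ℝ) → Fin n → ℝ, IsProjOn est (Kset r n V) →
          risk σ est θstar ≤
              C * max ((σ ^ 2 * V ^ ((1 : ℝ) / (r : ℝ)) / (n : ℝ)) ^
                  (2 * (r : ℝ) / (2 * (r : ℝ) + 1)))
                (σ ^ 2 / (n : ℝ) * Real.log (Real.exp 1 * (n : ℝ))) ∧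
            ∀ x : ℝ, 0 < x →
              ENNReal.ofReal (1 - Real.exp (-x)) ≤
                gaussVec n σ {ξ | 1 / (n : ℝ) * sqnorm (est (θstar + ξ) - θstar) ≤
                  C * max ((σ ^ 2 * V ^ ((1 : ℝ) / (r : ℝ)) / (n : ℝ)) ^
                      (2 * (r : ℝ) / (2 * (r : ℝ) + 1)))
                    (σ ^ 2 / (n : ℝ) * Real.log (Real.exp 1 * (n : ℝ))) +
                    4 * σ ^ 2 * x / (n : ℝ)} := by
  classical
  obtain ⟨C0, hC0, hbasis⟩ := basis_exists r hr
  refine ⟨32 * C0 + 8, by positivity, ?_⟩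
  intro n hn σ hσ θ V hV hθV est hest
  have hn0 : 0 < n := by omega
  have hn' : (0 : ℝ) < n := by exact_mod_cast hn0
  have hn1 : (1 : ℝ) ≤ n := by exact_mod_cast hn0
  have hθ : θ ∈ Kset r n V := by
    simp only [Kset, Set.mem_ofPred_eq]
    have e : (n : ℝ) ^ (1 - (r : ℤ)) = ((n : ℝ) ^ ((r : ℤ) - 1))⁻¹ := by
      rw [← zpow_neg]; congr 1; ring
    rw [e, ← div_eq_mul_inv, le_div_iff₀ (by positivity), mul_comm]
    exact hθV
  set a := (σ ^ 2 * V ^ ((1 : ℝ) / (r : ℝ)) / (n : ℝ)) ^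
    (2 * (r : ℝ) / (2 * (r : ℝ) + 1)) with ha
  set l := σ ^ 2 / (n : ℝ) * Real.log (Real.exp 1 * (n : ℝ)) with hl
  have hl1 : σ ^ 2 / n ≤ l := by
    rw [hl, Real.log_mul (Real.exp_pos 1).ne' hn'.ne', Real.log_exp]
    have := Real.log_nonneg hn1
    have h2 : 0 ≤ σ ^ 2 / (n : ℝ) := by positivity
    nlinarith
  set mx := max a l with hmx
  have hma : a ≤ mx := le_max_left _ _
  have hml : σ ^ 2 / n ≤ mx := hl1.trans (le_max_right _ _)
  have hmx0 : 0 ≤ mx := le_trans (by positivity) hml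
  let P : ℕ → Prop := fun M => 2 ^ M ≤ n ∧
    V ^ 2 * ((2 : ℝ) ^ M) ^ (2 * r + 1) ≤ σ ^ 2 * (n : ℝ) ^ (2 * r)
  by_cases hP0 : P 0
  · set M := Nat.findGreatest P n with hM
    have hPM : P M := Nat.findGreatest_spec (Nat.zero_le n) hP0
    have hPM1 : ¬ P (M + 1) := by
      intro h
      have h1 : M + 1 ≤ n := (Nat.lt_two_pow_self).le.trans h.1
      exact Nat.findGreatest_is_greatest (Nat.lt_succ_self M) h1 h
    set L : ℝ := (2 : ℝ) ^ M with hL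
    have hL0 : 0 < L := by positivity
    have hrate : σ ^ 2 / L ≤ 2 * mx := by
      have e : (2 : ℝ) ^ (M + 1) = 2 * L := by rw [hL]; ring
      have key : σ ^ 2 / (2 * L) ≤ mx := by
        by_cases h2 : 2 ^ (M + 1) ≤ n
        · have h3 : ¬ (V ^ 2 * ((2 : ℝ) ^ (M + 1)) ^ (2 * r + 1) ≤ σ ^ 2 * (n : ℝ) ^ (2 * r)) :=
            fun h => hPM1 ⟨h2, h⟩
          rw [e] at h3
          push Not at h3
          exact (rate_bound r hr n hn0 σ V (2 * L) hσ hV (by positivity) h3.le).trans hma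
        · refine le_trans ?_ hml
          apply div_le_div_of_nonneg_left (by positivity) hn'
          rw [← e]
          push Not at h2
          exact_mod_cast h2.le
      have : σ ^ 2 / L = 2 * (σ ^ 2 / (2 * L)) := by field_simp
      rw [this]; linarith
    obtain ⟨ι, hι, b, lam, hlam, hN, hb⟩ := hbasis n M
    refine abstract_bound r hn0 b lam hlam σ hσ _ (by positivity) hb _ hN V est hest θ hθ _ ?_
    have hVL : V * (L ^ (r - 1) * √L) * (n : ℝ) ^ (1 - (r : ℤ)) ≤ σ * n / L := by
      have h1 : V * (L ^ r * √L) ≤ σ * (n : ℝ) ^ r := by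
        refine le_of_sq_le_sq ?_ (by positivity)
        calc (V * (L ^ r * √L)) ^ 2 = V ^ 2 * (L ^ (2 * r) * √L ^ 2) := by ring
          _ = V ^ 2 * L ^ (2 * r + 1) := by rw [Real.sq_sqrt hL0.le]; ring
          _ ≤ σ ^ 2 * (n : ℝ) ^ (2 * r) := hPM.2
          _ = _ := by ring
      have e1 : (n : ℝ) ^ (1 - (r : ℤ)) = n / (n : ℝ) ^ r := by
        rw [zpow_sub₀ hn'.ne', zpow_one, zpow_natCast]
      have e2 : L ^ r = L ^ (r - 1) * L := by
        rw [← pow_succ, Nat.sub_add_cancel hr]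
      rw [e1, le_div_iff₀ hL0]
      calc V * (L ^ (r - 1) * √L) * (n / (n : ℝ) ^ r) * L
          = V * (L ^ r * √L) * (n / (n : ℝ) ^ r) := by rw [e2]; ring
        _ ≤ σ * (n : ℝ) ^ r * (n / (n : ℝ) ^ r) := mul_le_mul_of_nonneg_right h1 (by positivity)
        _ = σ * n := by field_simp
    have t1 : 8 * σ ^ 2 * (C0 * ((n : ℝ) / L + 1)) ≤ 24 * C0 * n * mx := by
      have : 8 * σ ^ 2 * (C0 * ((n : ℝ) / L + 1)) = 8 * C0 * n * (σ ^ 2 / L + σ ^ 2 / n) := by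
        field_simp
      rw [this]
      calc 8 * C0 * n * (σ ^ 2 / L + σ ^ 2 / n) ≤ 8 * C0 * n * (3 * mx) :=
            mul_le_mul_of_nonneg_left (by linarith) (by positivity)
        _ = _ := by ring
    have t2 : 4 * σ * (C0 * (L ^ (r - 1) * √L)) * (V * (n : ℝ) ^ (1 - (r : ℤ))) ≤
        8 * C0 * n * mx := by
      calc 4 * σ * (C0 * (L ^ (r - 1) * √L)) * (V * (n : ℝ) ^ (1 - (r : ℤ)))
          = 4 * σ * C0 * (V * (L ^ (r - 1) * √L) * (n : ℝ) ^ (1 - (r : ℤ))) := by ring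
        _ ≤ 4 * σ * C0 * (σ * n / L) := mul_le_mul_of_nonneg_left hVL (by positivity)
        _ = 4 * C0 * n * (σ ^ 2 / L) := by ring
        _ ≤ 4 * C0 * n * (2 * mx) := mul_le_mul_of_nonneg_left hrate (by positivity)
        _ = _ := by ring
    have t3 : 0 ≤ n * mx := by positivity
    linarith
  · have h3 : σ ^ 2 * (n : ℝ) ^ (2 * r) ≤ V ^ 2 * 1 ^ (2 * r + 1) := by
      by_contra hcon
      push Not at hcon
      exact hP0 ⟨by rw [pow_zero]; exact hn0, by simpa using hcon.le⟩
    have h4 := (rate_bound r hr n hn0 σ V 1 hσ hV one_pos h3).trans hma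
    rw [div_one] at h4
    refine abstract_bound r hn0 (EuclideanSpace.basisFun (Fin n) ℝ) (fun _ => 0) (fun _ => le_rfl)
      σ hσ 0 le_rfl (by intro u; simp) n (by simp) V est hest θ hθ _ ?_
    have t3 : 0 ≤ n * mx := by positivity
    have t4 : (n : ℝ) * σ ^ 2 ≤ n * mx := mul_le_mul_of_nonneg_left h4 hn'.le
    have t5 : 0 ≤ C0 * (n * mx) := by positivity
    linarith
end
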